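/- Let D be a finitely supported probability distribution on ℝ^d × {−1, 1}, let w* be a unit vector, and let η < 1/2 be such that for every x in the support of the marginal of D, P_{(x',y)∼D}[y ≠ sign(⟨w*,x⟩) | x' = x] ≤ η (Massart noise with rate η). Let σ > 0, C₀ ≥ 1, and let ℓ : ℝ → [0,1] be continuously differentiable with: ℓ(t) = 1/2 + t/σ on [−σ/6, σ/6]; ℓ(t) = 1 for t > σ/2 and ℓ(t) = 0 for t < −σ/2; ℓ'(t) ∈ [0, C₀/σ] and ℓ'(−t) = ℓ'(t) for all t. Define L(u) = E_{(x,y)∼D}[ℓ(−y·⟨u,x⟩/‖u‖)] for u ≠ 0. Let w be a unit vector with θ = ∠(w,w*) ∈ (0, π/2), let v be the unit vector in span(w,w*) with ⟨v,w⟩ = 0 and ⟨v,w*⟩ < 0, and let α ≥ σ/(2 tan θ). Then ‖∇L(w)‖ ≥ (1 − 2η)·(α/σ)·P_{(x,y)∼D}[|⟨v,x⟩| ≥ α and |⟨w,x⟩| ≤ σ/6] − (C₀/(2 tan θ))·P_{(x,y)∼D}[|⟨w,x⟩| ≤ σ/2]. -/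

import Mathlib

open MeasureTheory
open scoped RealInnerProductSpace ENNReal

/-- `sgn t = 1` if `t ≥ 0` and `sgn t = -1` if `t < 0`. -/
noncomputable def sgn (t : ℝ) : ℝ := if 0 ≤ t then 1 else -1

lemma sgn_eq_one_or (t : ℝ) : sgn t = 1 ∨ sgn t = -1 := by
  unfold sgn
  split_ifs <;> simp

/-- A real-valued function on a finitely supported finite measure space integrates to the weighted
sum of its values. -/
lemma integral_eq_sum_of_compl_null {X : Type*} [MeasurableSpace X] [MeasurableSingletonClass X]
    (D : Measure X) [IsFiniteMeasure D] (s : Finset X) (hs : D ((s : Set X)ᶜ) = 0) (f : X → ℝ) :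
    ∫ p, f p ∂D = ∑ p ∈ s, D.real {p} * f p := by
  have hD : D.restrict (s : Set X) = D := Measure.restrict_eq_self_of_ae_mem (by
    rw [ae_iff]
    exact hs)
  conv_lhs => rw [← hD]
  rw [setIntegral_finset s IntegrableOn.finset]
  simp

open Classical in
lemma measureReal_eq_sum_of_compl_null {X : Type*} [MeasurableSpace X]
    [MeasurableSingletonClass X] (D : Measure X) [IsFiniteMeasure D] (s : Finset X)
    (hs : D ((s : Set X)ᶜ) = 0) (A : Set X) :
    (D A).toReal = ∑ p ∈ s, D.real {p} * (if p ∈ A then 1 else 0) := by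
  have h : D A = D ((s.filter (· ∈ A) : Finset X) : Set X) := by
    refine measure_congr ?_
    have : ∀ᵐ p ∂D, p ∈ (s : Set X) := by
      rw [ae_iff]
      exact hs
    filter_upwards [this] with p hp
    have hp' : p ∈ s := hp
    refine propext ?_
    change p ∈ A ↔ p ∈ ((s.filter (· ∈ A) : Finset X) : Set X)
    simp [hp']
  have h2 := sum_measureReal_singleton (μ := D) (s.filter (· ∈ A))
  rw [h, ← measureReal_def, ← h2, Finset.sum_filter]
  simp

/-- A nonnegative function of the point alone is charged by the event `B` at most `η` times its
total sum, if `B` has conditional weight at most `η` on each fibre. -/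
lemma sum_mul_indicator_le {X Y : Type*} [DecidableEq X] (s : Finset (X × Y)) (c : X × Y → ℝ)
    (B : X × Y → ℝ) (η : ℝ) (h : X → ℝ) (hh : ∀ x, 0 ≤ h x)
    (hB : ∀ x, ∑ p ∈ s with p.1 = x, c p * B p ≤ η * ∑ p ∈ s with p.1 = x, c p) :
    ∑ p ∈ s, c p * (h p.1 * B p) ≤ η * ∑ p ∈ s, c p * h p.1 := by
  have hmap : ∀ p ∈ s, p.1 ∈ s.image Prod.fst := fun p hp => Finset.mem_image_of_mem _ hp
  rw [← Finset.sum_fiberwise_of_maps_to hmap, ← Finset.sum_fiberwise_of_maps_to hmap,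
    Finset.mul_sum]
  refine Finset.sum_le_sum fun x _ => ?_
  have h1 : ∑ p ∈ s with p.1 = x, c p * (h p.1 * B p)
      = h x * ∑ p ∈ s with p.1 = x, c p * B p := by
    rw [Finset.mul_sum]
    refine Finset.sum_congr rfl fun p hp => ?_
    rw [(Finset.mem_filter.1 hp).2]
    ring
  have h2 : ∑ p ∈ s with p.1 = x, c p * h p.1 = h x * ∑ p ∈ s with p.1 = x, c p := by
    rw [Finset.mul_sum]
    refine Finset.sum_congr rfl fun p hp => ?_
    rw [(Finset.mem_filter.1 hp).2]
    ring
  rw [h1, h2]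
  nlinarith [mul_le_mul_of_nonneg_left (hB x) (hh x)]

/-- Derivative of a smoothed normalized linear form along a tangent direction. -/
lemma hasDerivAt_comp_normalized {ℓ : ℝ → ℝ} (hℓ : Differentiable ℝ ℓ) (y a b : ℝ) :
    HasDerivAt (fun t : ℝ => ℓ (-y * (a + t * b) / √(1 + t ^ 2)))
      (deriv ℓ (-y * a) * (-y * b)) 0 := by
  have h1 : HasDerivAt (fun t : ℝ => √(1 + t ^ 2)) 0 0 := by
    have h : HasDerivAt (fun t : ℝ => 1 + t ^ 2) 0 0 := by
      simpa using ((hasDerivAt_id (0 : ℝ)).pow 2).const_add 1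
    simpa using h.sqrt (by norm_num)
  have h2 : HasDerivAt (fun t : ℝ => -y * (a + t * b)) (-y * b) 0 := by
    simpa using (((hasDerivAt_id (0 : ℝ)).mul_const b).const_add a).const_mul (-y)
  have h3 : HasDerivAt (fun t : ℝ => -y * (a + t * b) / √(1 + t ^ 2)) (-y * b) 0 := by
    simpa using h2.fun_div h1 (by norm_num)
  have h4 : HasDerivAt ℓ (deriv ℓ (-y * a)) (-y * (a + 0 * b) / √(1 + 0 ^ 2)) := by
    simpa using (hℓ (-y * a)).hasDerivAt
  exact h4.comp 0 h3

lemma norm_add_smul_of_orthonormal {E : Type*} [NormedAddCommGroup E] [InnerProductSpace ℝ E]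
    {w v : E} (hw : ‖w‖ = 1) (hv : ‖v‖ = 1) (hvw : ⟪v, w⟫ = 0) (t : ℝ) :
    ‖w + t • v‖ = √(1 + t ^ 2) := by
  rw [← Real.sqrt_sq (norm_nonneg (w + t • v)), norm_add_sq_real, inner_smul_right,
    real_inner_comm, hvw, norm_smul, hw, hv]
  simp

/-- The derivative of the surrogate loss of a finite weighted sample, in a tangent direction. -/
lemma inner_gradient_sum {E : Type*} [NormedAddCommGroup E] [InnerProductSpace ℝ E]
    [CompleteSpace E] {ℓ : ℝ → ℝ} (hℓ : Differentiable ℝ ℓ) (s : Finset (E × ℝ))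
    (c : E × ℝ → ℝ) {w v : E} (hw : ‖w‖ = 1) (hv : ‖v‖ = 1) (hvw : ⟪v, w⟫ = 0) :
    ⟪gradient (fun u => ∑ p ∈ s, c p * ℓ (-(p.2) * ⟪u, p.1⟫ / ‖u‖)) w, v⟫
      = ∑ p ∈ s, c p * (deriv ℓ (-p.2 * ⟪w, p.1⟫) * (-p.2 * ⟪v, p.1⟫)) := by
  have hw0 : w ≠ 0 := by
    rintro rfl
    simp at hw
  set L : E → ℝ := fun u => ∑ p ∈ s, c p * ℓ (-(p.2) * ⟪u, p.1⟫ / ‖u‖) with hL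
  have hdiff : DifferentiableAt ℝ L w := by
    refine DifferentiableAt.fun_sum fun p _ => DifferentiableAt.const_mul ?_ _
    refine (hℓ _).comp w (f := fun u => -(p.2) * ⟪u, p.1⟫ / ‖u‖) ?_
    have hid : DifferentiableAt ℝ (fun u : E => u) w := differentiableAt_id
    simp only [div_eq_mul_inv]
    exact ((hid.inner ℝ (differentiableAt_const p.1)).const_mul _).fun_mul
      ((hid.norm ℝ hw0).fun_inv (norm_ne_zero_iff.2 hw0))
  have hline : HasDerivAt (fun t : ℝ => w + t • v) v 0 := by
    simpa using ((hasDerivAt_id (0 : ℝ)).smul_const v).const_add w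
  have hf : HasFDerivAt L (fderiv ℝ L w) (w + (0 : ℝ) • v) := by
    simpa using hdiff.hasFDerivAt
  have h1 : HasDerivAt (fun t : ℝ => L (w + t • v)) (fderiv ℝ L w v) 0 :=
    HasFDerivAt.comp_hasDerivAt (f := fun t : ℝ => w + t • v) 0 hf hline
  have h2 : HasDerivAt (fun t : ℝ => L (w + t • v))
      (∑ p ∈ s, c p * (deriv ℓ (-p.2 * ⟪w, p.1⟫) * (-p.2 * ⟪v, p.1⟫))) 0 := by
    have := HasDerivAt.fun_sum (u := s) fun p _ =>
      (hasDerivAt_comp_normalized hℓ p.2 ⟪w, p.1⟫ ⟪v, p.1⟫).const_mul (c p)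
    simpa only [hL, norm_add_smul_of_orthonormal hw hv hvw, inner_add_left,
      real_inner_smul_left] using this
  rw [← h1.unique h2, gradient, InnerProductSpace.toDual_symm_apply]

/-- A unit vector of the plane of `w` and `z`, orthogonal to `w` and on the far side of `z`, gives
the orthonormal decomposition of `z`. -/
lemma eq_cos_smul_sub_sin_smul {E : Type*} [NormedAddCommGroup E] [InnerProductSpace ℝ E]
    {w z v : E} (hw : ‖w‖ = 1) (hz : ‖z‖ = 1) {θ : ℝ} (hθ : θ = InnerProductGeometry.angle w z)
    (hsin : 0 < Real.sin θ) (hv : ‖v‖ = 1) (hspan : v ∈ Submodule.span ℝ {w, z})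
    (hvw : ⟪v, w⟫ = 0) (hvz : ⟪v, z⟫ < 0) :
    z = Real.cos θ • w - Real.sin θ • v := by
  obtain ⟨p, q, hpq⟩ := Submodule.mem_span_pair.1 hspan
  have hc : ⟪w, z⟫ = Real.cos θ := by
    rw [hθ, InnerProductGeometry.cos_angle, hw, hz]
    simp
  have hww : ⟪w, w⟫ = 1 := by rw [real_inner_self_eq_norm_sq, hw]; norm_num
  have hzz : ⟪z, z⟫ = 1 := by rw [real_inner_self_eq_norm_sq, hz]; norm_num
  have hvv : ⟪v, v⟫ = 1 := by rw [real_inner_self_eq_norm_sq, hv]; norm_num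
  have hzw : ⟪z, w⟫ = Real.cos θ := by rw [real_inner_comm, hc]
  have e1 : p + q * Real.cos θ = 0 := by
    rw [← hvw, ← hpq, inner_add_left, real_inner_smul_left, real_inner_smul_left, hww, hzw]
    ring
  have e2 : ⟪v, z⟫ = p * Real.cos θ + q := by
    rw [← hpq, inner_add_left, real_inner_smul_left, real_inner_smul_left, hzz, hc]
    ring
  have e3 : q * ⟪v, z⟫ = 1 := by
    have h : ⟪v, p • w + q • z⟫ = 1 := by rw [hpq, hvv]
    rwa [inner_add_right, real_inner_smul_right, real_inner_smul_right, hvw, mul_zero,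
      zero_add] at h
  have hp : p = -(q * Real.cos θ) := by linarith
  have e4 : ⟪v, z⟫ = q * Real.sin θ ^ 2 := by
    rw [e2, hp, Real.sin_sq]
    ring
  have hq : q * Real.sin θ = -1 := by
    have hsq : (q * Real.sin θ) ^ 2 = 1 := by
      rw [← e3, e4]
      ring
    have hneg : q * Real.sin θ < 0 := by
      rw [e4] at hvz
      nlinarith
    rcases eq_or_eq_neg_of_sq_eq_sq _ 1 (hsq.trans (one_pow 2).symm) with h | h
    · linarith
    · exact h
  have : Real.sin θ • v = Real.cos θ • w - z := by
    rw [← hpq, smul_add, smul_smul, smul_smul, hp, mul_comm _ q, hq]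
    have : Real.sin θ * -(q * Real.cos θ) = Real.cos θ := by
      linear_combination (-Real.cos θ) * hq
    rw [this]
    simp [sub_eq_add_neg]
  rw [this]
  simp

/-- Pointwise bound on the contribution of a point with coordinates `a` along `w` and `b` along
`v`, where `g` is the slope of the ramp at `a`. -/
lemma pointwise_contribution_le {η σ C α θ a b g : ℝ} (hη : η < 1 / 2) (hσ : 0 < σ)
    (hC : 1 ≤ C) (hsin : 0 < Real.sin θ) (hcos : 0 < Real.cos θ)
    (hα : σ / (2 * Real.tan θ) ≤ α) (hg0 : 0 ≤ g) (hgC : g ≤ C / σ)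
    (hgmid : |a| ≤ σ / 6 → g = 1 / σ) (hgout : σ / 2 < |a| → g = 0) :
    (1 - 2 * η) * (α / σ) * (if α ≤ |b| ∧ |a| ≤ σ / 6 then 1 else 0)
        - C / (2 * Real.tan θ) * (if |a| ≤ σ / 2 then 1 else 0)
      ≤ (1 - 2 * η) * max (-(sgn (Real.cos θ * a - Real.sin θ * b) * g * b)) 0
        - max (sgn (Real.cos θ * a - Real.sin θ * b) * g * b) 0 := by
  have hT : 0 < Real.tan θ := by
    rw [Real.tan_eq_sin_div_cos]
    positivity
  have hsT : Real.sin θ = Real.tan θ * Real.cos θ := (Real.tan_mul_cos hcos.ne').symm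
  set T := Real.tan θ
  set S := sgn (Real.cos θ * a - Real.sin θ * b) with hS
  have hSb : S * b ≤ |a| / T := by
    rw [le_div_iff₀ hT, hS, hsT]
    unfold sgn
    split_ifs with h
    · have : T * b ≤ a := by
        by_contra! h'
        nlinarith
      linarith [le_abs_self a]
    · have : a ≤ T * b := by
        by_contra! h'
        nlinarith
      linarith [neg_abs_le a]
  have hCT : 0 ≤ C / (2 * T) := by positivity
  have hα0 : 0 < α := lt_of_lt_of_le (by positivity) hα
  have hB : 0 ≤ C / (2 * T) * (if |a| ≤ σ / 2 then (1 : ℝ) else 0) := by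
    split_ifs <;> simp [hCT]
  by_cases hA : α ≤ |b| ∧ |a| ≤ σ / 6
  · have hlt : |a| / T < |b| := by
      refine lt_of_lt_of_le ?_ (hα.trans hA.1)
      rw [div_lt_div_iff₀ hT (by positivity)]
      nlinarith [hA.2, mul_pos hT hσ]
    have hneg : S * b = -|b| := by
      rcases sgn_eq_one_or (Real.cos θ * a - Real.sin θ * b) with h | h <;>
        rw [← hS] at h <;> rw [h] at hSb ⊢ <;> rcases abs_cases b with h' | h' <;> linarith
    have hprod : S * g * b = -(|b| / σ) := by
      rw [hgmid hA.2, mul_right_comm, hneg]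
      ring
    have hbσ : α / σ ≤ |b| / σ := by
      have := hA.1
      gcongr
    have hbσ0 : 0 ≤ |b| / σ := by positivity
    rw [if_pos hA, hprod, neg_neg, max_eq_left hbσ0, max_eq_right (by linarith)]
    nlinarith
  · rw [if_neg hA]
    have hmax : 0 ≤ (1 - 2 * η) * max (-(S * g * b)) 0 :=
      mul_nonneg (by linarith) (le_max_right _ _)
    by_cases ha : |a| ≤ σ / 2
    · rw [if_pos ha]
      have h1 : S * g * b ≤ C / (2 * T) := calc
        S * g * b = g * (S * b) := by ring
        _ ≤ g * (|a| / T) := by gcongr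
        _ ≤ (C / σ) * ((σ / 2) / T) := by gcongr
        _ = C / (2 * T) := by field_simp
      have := max_le h1 hCT
      linarith
    · rw [hgout (not_le.1 ha)]
      simp [ha]

/-- The slope of the ramp is `1 / σ` on the closed middle interval. -/
lemma deriv_eq_of_eq_affine_on_Icc {ℓ : ℝ → ℝ} (hℓ : Differentiable ℝ ℓ) {σ t : ℝ} (hσ : 0 < σ)
    (hmid : ∀ t ∈ Set.Icc (-σ / 6) (σ / 6), ℓ t = 1 / 2 + t / σ) (ht : |t| ≤ σ / 6) :
    deriv ℓ t = 1 / σ := by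
  have htm : t ∈ Set.Icc (-σ / 6) (σ / 6) := by
    rw [abs_le] at ht
    constructor <;> linarith
  have hu : UniqueDiffWithinAt ℝ (Set.Icc (-σ / 6) (σ / 6)) t :=
    uniqueDiffOn_Icc (by linarith) t htm
  have h1 : HasDerivWithinAt ℓ (1 / σ) (Set.Icc (-σ / 6) (σ / 6)) t := by
    have : HasDerivAt (fun t : ℝ => 1 / 2 + t / σ) (1 / σ) t :=
      ((hasDerivAt_id t).div_const σ).const_add _
    exact this.hasDerivWithinAt.congr hmid (hmid t htm)
  exact hu.eq_deriv _ (hℓ t).hasDerivAt.hasDerivWithinAt h1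

lemma deriv_eq_zero_of_eq_const_outside {ℓ : ℝ → ℝ} {r A B t : ℝ}
    (hone : ∀ t, r < t → ℓ t = A) (hzero : ∀ t, t < -r → ℓ t = B) (ht : r < |t|) :
    deriv ℓ t = 0 := by
  rcases lt_abs.1 ht with h | h
  · have : ℓ =ᶠ[nhds t] fun _ => A := by
      filter_upwards [Ioi_mem_nhds h] with u hu using hone u hu
    rw [this.deriv_eq, deriv_const]
  · have : ℓ =ᶠ[nhds t] fun _ => B := by
      filter_upwards [Iio_mem_nhds (show t < -r by linarith)] with u hu using hzero u hu
    rw [this.deriv_eq, deriv_const]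


/-- Structural gradient lower bound for the smoothed surrogate loss (Massart case):
for a finitely supported labeled distribution `D` on `ℝ^d × {±1}` whose labels
satisfy the Massart condition with rate `η < 1/2` relative to the halfspace with
unit normal `w*` (for every point `x`, the conditional probability of a flipped label
is at most `η`), a smoothed ramp `ℓ` of width `σ` with slope bound `C₀/σ`, and a unit
vector `w` at angle `θ ∈ (0, π/2)` from `w*`, with `v` the unit vector in
`span(w,w*)` orthogonal to `w` with `⟨v,w*⟩ < 0`, the gradient of the surrogate loss
`L(u) = E[ℓ(−y⟨u,x⟩/‖u‖)]` at `w` satisfies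
`‖∇L(w)‖ ≥ (1−2η)·(α/σ)·P[|⟨v,x⟩| ≥ α ∧ |⟨w,x⟩| ≤ σ/6]
 − (C₀/(2 tan θ))·P[|⟨w,x⟩| ≤ σ/2]`. -/
theorem surrogate_gradient_lower_bound_massart
    (d : ℕ)
    (D : Measure (EuclideanSpace ℝ (Fin d) × ℝ)) [IsProbabilityMeasure D]
    (hfin : ∃ s : Finset (EuclideanSpace ℝ (Fin d) × ℝ), D ((↑s : Set _)ᶜ) = 0)
    (hlabel : D {p | p.2 = 1 ∨ p.2 = -1}ᶜ = 0)
    (wstar : EuclideanSpace ℝ (Fin d)) (hwstar : ‖wstar‖ = 1)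
    (η : ℝ) (hη0 : 0 ≤ η) (hη : η < 1 / 2)
    (hmassart : ∀ x : EuclideanSpace ℝ (Fin d),
      D {p | p.1 = x ∧ p.2 ≠ sgn ⟪wstar, x⟫} ≤ ENNReal.ofReal η * D {p | p.1 = x})
    (σ C₀ : ℝ) (hσ : 0 < σ) (hC₀ : 1 ≤ C₀)
    (ℓ : ℝ → ℝ) (hℓC1 : ContDiff ℝ 1 ℓ)
    (hℓ01 : ∀ t, ℓ t ∈ Set.Icc (0 : ℝ) 1)
    (hℓmid : ∀ t ∈ Set.Icc (-σ / 6) (σ / 6), ℓ t = 1 / 2 + t / σ)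
    (hℓone : ∀ t, σ / 2 < t → ℓ t = 1)
    (hℓzero : ∀ t, t < -σ / 2 → ℓ t = 0)
    (hℓderiv : ∀ t, deriv ℓ t ∈ Set.Icc (0 : ℝ) (C₀ / σ))
    (hℓeven : ∀ t, deriv ℓ (-t) = deriv ℓ t)
    (w : EuclideanSpace ℝ (Fin d)) (hw : ‖w‖ = 1)
    (θ : ℝ) (hθ : θ = InnerProductGeometry.angle w wstar)
    (hθ0 : 0 < θ) (hθ1 : θ < Real.pi / 2)
    (v : EuclideanSpace ℝ (Fin d)) (hv : ‖v‖ = 1)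
    (hvspan : v ∈ Submodule.span ℝ {w, wstar})
    (hvw : ⟪v, w⟫ = 0) (hvws : ⟪v, wstar⟫ < 0)
    (α : ℝ) (hα : σ / (2 * Real.tan θ) ≤ α) :
    (1 - 2 * η) * (α / σ) * (D {p | α ≤ |⟪v, p.1⟫| ∧ |⟪w, p.1⟫| ≤ σ / 6}).toReal
      - (C₀ / (2 * Real.tan θ)) * (D {p | |⟪w, p.1⟫| ≤ σ / 2}).toReal
      ≤ ‖gradient (fun u => ∫ p, ℓ (-(p.2) * ⟪u, p.1⟫ / ‖u‖) ∂D) w‖ := by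
  classical
  have hsin : 0 < Real.sin θ := Real.sin_pos_of_pos_of_lt_pi hθ0 (by linarith [Real.pi_pos])
  have hcos : 0 < Real.cos θ := Real.cos_pos_of_mem_Ioo ⟨by linarith [Real.pi_pos], hθ1⟩
  have hdecomp := eq_cos_smul_sub_sin_smul hw hwstar hθ hsin hv hvspan hvw hvws
  have hℓd : Differentiable ℝ ℓ := hℓC1.differentiable one_ne_zero
  obtain ⟨s₀, hs₀⟩ := hfin
  obtain ⟨s, hs, hys⟩ : ∃ s : Finset (EuclideanSpace ℝ (Fin d) × ℝ),
      D ((↑s : Set _)ᶜ) = 0 ∧ ∀ p ∈ s, p.2 = 1 ∨ p.2 = -1 := by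
    refine ⟨s₀.filter fun p => p.2 = 1 ∨ p.2 = -1, ?_, fun p hp => (Finset.mem_filter.1 hp).2⟩
    refine measure_mono_null ?_ (measure_union_null hs₀ hlabel)
    intro p hp
    simp only [Finset.coe_filter, Set.mem_compl_iff, Set.mem_ofPred_eq, Set.mem_union,
      Finset.mem_coe] at hp ⊢
    tauto
  set c : EuclideanSpace ℝ (Fin d) × ℝ → ℝ := fun p => D.real {p} with hc
  have hc0 : ∀ p, 0 ≤ c p := fun p => measureReal_nonneg
  have hloss : (fun u => ∫ p, ℓ (-(p.2) * ⟪u, p.1⟫ / ‖u‖) ∂D)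
      = fun u => ∑ p ∈ s, c p * ℓ (-(p.2) * ⟪u, p.1⟫ / ‖u‖) :=
    funext fun u => integral_eq_sum_of_compl_null D s hs _
  set S : EuclideanSpace ℝ (Fin d) → ℝ := fun x => sgn ⟪wstar, x⟫ with hS
  set H : EuclideanSpace ℝ (Fin d) → ℝ := fun x => S x * deriv ℓ ⟪w, x⟫ * ⟪v, x⟫ with hH
  set B : EuclideanSpace ℝ (Fin d) × ℝ → ℝ := fun p => if p.2 ≠ S p.1 then 1 else 0 with hB
  have hBnn : ∀ p, 0 ≤ B p := fun p => by
    simp only [hB]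
    split_ifs <;> norm_num
  have hfib : ∀ x, ∑ p ∈ s with p.1 = x, c p * B p ≤ η * ∑ p ∈ s with p.1 = x, c p := by
    intro x
    have h := ENNReal.toReal_mono (by finiteness) (hmassart x)
    rw [ENNReal.toReal_mul, ENNReal.toReal_ofReal hη0,
      measureReal_eq_sum_of_compl_null D s hs, measureReal_eq_sum_of_compl_null D s hs] at h
    convert h using 1
    · rw [Finset.sum_filter]
      refine Finset.sum_congr rfl fun p _ => ?_
      by_cases hp : p.1 = x
      · subst hp
        simp [hB, hS, hc]
      · simp [hp]
    · rw [Finset.sum_filter]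
      simp [hc]
  have hpos := sum_mul_indicator_le s c B η (fun x => max (-H x) 0) (fun _ => le_max_right _ _) hfib
  have hterm : ∀ p ∈ s, c p * (deriv ℓ (-p.2 * ⟪w, p.1⟫) * (-p.2 * ⟪v, p.1⟫))
      = c p * (-H p.1 * (1 - 2 * B p)) := by
    intro p hp
    have hd : deriv ℓ (-p.2 * ⟪w, p.1⟫) = deriv ℓ ⟪w, p.1⟫ := by
      rcases hys p hp with h | h <;> simp [h, hℓeven]
    have hy : p.2 = S p.1 * (1 - 2 * B p) := by
      rcases hys p hp with h | h <;> rcases sgn_eq_one_or ⟪wstar, p.1⟫ with h' | h' <;>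
        simp only [hB, hS, h, h'] <;> norm_num
    rw [hd]
    simp only [hH]
    linear_combination (-c p * deriv ℓ ⟪w, p.1⟫ * ⟪v, p.1⟫) * hy
  have hpoint : ∀ x : EuclideanSpace ℝ (Fin d),
      (1 - 2 * η) * (α / σ) * (if α ≤ |⟪v, x⟫| ∧ |⟪w, x⟫| ≤ σ / 6 then 1 else 0)
        - C₀ / (2 * Real.tan θ) * (if |⟪w, x⟫| ≤ σ / 2 then 1 else 0)
      ≤ (1 - 2 * η) * max (-H x) 0 - max (H x) 0 := by
    intro x
    have hinner : ⟪wstar, x⟫ = Real.cos θ * ⟪w, x⟫ - Real.sin θ * ⟪v, x⟫ := by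
      rw [hdecomp, inner_sub_left, real_inner_smul_left, real_inner_smul_left]
    simp only [hH, hS, hinner]
    exact pointwise_contribution_le hη hσ hC₀ hsin hcos hα (hℓderiv _).1 (hℓderiv _).2
      (deriv_eq_of_eq_affine_on_Icc hℓd hσ hℓmid)
      (deriv_eq_zero_of_eq_const_outside hℓone fun t ht => hℓzero t (by linarith))
  have hnorm : ⟪gradient (fun u => ∑ p ∈ s, c p * ℓ (-(p.2) * ⟪u, p.1⟫ / ‖u‖)) w, v⟫
      ≤ ‖gradient (fun u => ∑ p ∈ s, c p * ℓ (-(p.2) * ⟪u, p.1⟫ / ‖u‖)) w‖ := by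
    simpa [hv] using real_inner_le_norm
      (gradient (fun u => ∑ p ∈ s, c p * ℓ (-(p.2) * ⟪u, p.1⟫ / ‖u‖)) w) v
  rw [hloss]
  refine le_trans ?_ hnorm
  rw [inner_gradient_sum hℓd s c hw hv hvw, Finset.sum_congr rfl hterm,
    measureReal_eq_sum_of_compl_null D s hs, measureReal_eq_sum_of_compl_null D s hs]
  calc _ = ∑ p ∈ s, c p * ((1 - 2 * η) * (α / σ) *
          (if α ≤ |⟪v, p.1⟫| ∧ |⟪w, p.1⟫| ≤ σ / 6 then 1 else 0)
        - C₀ / (2 * Real.tan θ) * (if |⟪w, p.1⟫| ≤ σ / 2 then 1 else 0)) := by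
        rw [Finset.mul_sum, Finset.mul_sum, ← Finset.sum_sub_distrib]
        refine Finset.sum_congr rfl fun p _ => ?_
        simp only [Set.mem_ofPred_eq, hc]
        ring_nf
    _ ≤ ∑ p ∈ s, c p * ((1 - 2 * η) * max (-H p.1) 0 - max (H p.1) 0) :=
        Finset.sum_le_sum fun p _ => mul_le_mul_of_nonneg_left (hpoint p.1) (hc0 p)
    _ = ∑ p ∈ s, c p * (max (-H p.1) 0 - max (H p.1) 0)
          - 2 * (η * ∑ p ∈ s, c p * max (-H p.1) 0) := by
        rw [Finset.mul_sum, Finset.mul_sum, ← Finset.sum_sub_distrib]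
        exact Finset.sum_congr rfl fun p _ => by ring
    _ ≤ ∑ p ∈ s, c p * (max (-H p.1) 0 - max (H p.1) 0)
          - 2 * ∑ p ∈ s, c p * (max (-H p.1) 0 * B p) := by linarith
    _ = ∑ p ∈ s, c p * (max (-H p.1) 0 * (1 - 2 * B p) - max (H p.1) 0) := by
        rw [Finset.mul_sum, ← Finset.sum_sub_distrib]
        exact Finset.sum_congr rfl fun p _ => by ring
    _ ≤ ∑ p ∈ s, c p * (-H p.1 * (1 - 2 * B p)) := by
        refine Finset.sum_le_sum fun p _ => mul_le_mul_of_nonneg_left ?_ (hc0 p)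
        have h1 : -H p.1 = max (-H p.1) 0 - max (H p.1) 0 := by
          rcases le_total (H p.1) 0 with h | h
          · rw [max_eq_left (by linarith), max_eq_right h, sub_zero]
          · rw [max_eq_right (by linarith), max_eq_left h, zero_sub]
        have h2 := mul_nonneg (le_max_right (H p.1) 0) (hBnn p)
        have h3 : -H p.1 * (1 - 2 * B p)
            = (max (-H p.1) 0 - max (H p.1) 0) * (1 - 2 * B p) :=
          congrArg (· * (1 - 2 * B p)) h1
        rw [h3]
        nlinarith
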